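/- Let p be a positive integer and let f(z) = ∑_{k≥0} a_{pk+1} z^{pk+1} be a p-symmetric analytic function in 𝔻 with |f(z)| ≤ 1 in 𝔻, and write a = |a_1|. Then for every 0 < r < 1 and every ρ > 1 with ρ r ≤ 1, one has ∑_{k≥1} |a_{pk+1}| r^{pk} ≤ r^p (1 − a^2) / ( √(1 − a^2 r^p ρ^p) · √(1 − ρ^{−p} r^p) ). -/

import Mathlib

open MeasureTheory AddCircle in
lemma aux_l2 (b : ℕ → ℂ) (hbs : Summable fun k => ‖b k‖) (c : ℂ) (s : ℝ) (hs : 0 ≤ s)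
    (H : ∀ (e : ℂ) (g : ℂ), ‖e‖ = 1 → HasSum (fun k : ℕ => b k * e ^ (k + 1)) g →
      ‖g‖ ≤ s * ‖((1 - ‖c‖ ^ 2 : ℝ) : ℂ) - (starRingEnd ℂ) c * g‖) (n : ℕ) :
    (∑ k ∈ Finset.range n, ‖b k‖ ^ 2) * (1 - ‖c‖ ^ 2 * s ^ 2) ≤ s ^ 2 * (1 - ‖c‖ ^ 2) ^ 2 := by
  have hsum : Summable (fun k : ℕ => b k • (fourier ((k : ℤ) + 1) : C(UnitAddCircle, ℂ))) := by
    apply Summable.of_norm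
    simpa [norm_smul, fourier_norm] using hbs
  obtain ⟨G, hG⟩ := hsum
  have hGx : ∀ x : UnitAddCircle, HasSum (fun k : ℕ => b k * (fourier 1 x : ℂ) ^ (k + 1)) (G x) := by
    intro x
    have h := ContinuousMap.hasSum_apply hG x
    convert h using 2 with k
    rw [ContinuousMap.smul_apply, smul_eq_mul]
    congr 1
    have : ∀ m : ℕ, (fourier 1 x : ℂ) ^ m = fourier (m : ℤ) x := by
      intro m
      induction m with
      | zero => simp
      | succ m ih => rw [pow_succ, ih, Nat.cast_succ, fourier_add]
    rw [this]; push_cast; rfl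
  have hpt : ∀ x : UnitAddCircle, ‖G x‖ ≤ s * ‖((((1 - ‖c‖ ^ 2 : ℝ) : ℂ) • fourier 0 - (starRingEnd ℂ) c • G : C(UnitAddCircle, ℂ))) x‖ := by
    intro x
    have h := H (fourier 1 x) (G x) (by rw [fourier_one]; exact Circle.norm_coe _) (hGx x)
    simpa using h
  let L := ContinuousMap.toLp (E := ℂ) 2 (@haarAddCircle (1:ℝ) _) ℂ
  let F := L G
  have hF : HasSum (fun k : ℕ => b k • fourierLp (T := (1:ℝ)) 2 ((k : ℤ) + 1)) F := by
    have := hG.mapL L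
    simpa [L, fourierLp] using this
  have hin : ∀ j : ℤ, HasSum (fun k : ℕ => b k * inner ℂ (fourierLp (T := (1:ℝ)) 2 j) (fourierLp (T := (1:ℝ)) 2 ((k : ℤ) + 1))) (inner ℂ (fourierLp (T := (1:ℝ)) 2 j) F) := by
    intro j
    have := hF.mapL (innerSL ℂ (fourierLp (T := (1:ℝ)) 2 j))
    simpa [innerSL_apply_apply, inner_smul_right] using this
  have ho := orthonormal_fourier (T := (1:ℝ))
  rw [orthonormal_iff_ite] at ho
  have h0 : inner ℂ (fourierLp (T := (1:ℝ)) 2 0) F = (0 : ℂ) := by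
    refine (hin 0).unique ?_
    have : (fun k : ℕ => b k * inner ℂ (fourierLp (T := (1:ℝ)) 2 0) (fourierLp (T := (1:ℝ)) 2 ((k : ℤ) + 1))) = fun _ => 0 := by
      ext k
      rw [ho, if_neg (by omega), mul_zero]
    rw [this]; exact hasSum_zero
  have hj : ∀ j : ℕ, inner ℂ (fourierLp (T := (1:ℝ)) 2 ((j : ℤ) + 1)) F = b j := by
    intro j
    refine (hin _).unique ?_
    convert hasSum_ite_eq j (b j) using 2 with k
    rw [ho]
    by_cases h : k = j
    · simp [h]
    · rw [if_neg (by omega), if_neg h, mul_zero]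
  have hbessel : ∑ k ∈ Finset.range n, ‖b k‖ ^ 2 ≤ ‖F‖ ^ 2 := by
    have ho2 : Orthonormal ℂ (fun k : ℕ => fourierLp (T := (1:ℝ)) 2 ((k : ℤ) + 1)) :=
      orthonormal_fourier.comp _ (fun a b h => by simpa using h)
    have := ho2.sum_inner_products_le (x := F) (s := Finset.range n)
    simpa only [hj] using this
  have hnorm : ‖F‖ ≤ s * ‖((1 - ‖c‖ ^ 2 : ℝ) : ℂ) • fourierLp (T := (1:ℝ)) 2 0 - (starRingEnd ℂ) c • F‖ := by
    have e : ((1 - ‖c‖ ^ 2 : ℝ) : ℂ) • fourierLp (T := (1:ℝ)) 2 0 - (starRingEnd ℂ) c • F =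
      L (((1 - ‖c‖ ^ 2 : ℝ) : ℂ) • fourier 0 - (starRingEnd ℂ) c • G) := by
      rw [map_sub, map_smul, map_smul]
    rw [e]
    apply Lp.norm_le_mul_norm_of_ae_le_mul
    filter_upwards [ContinuousMap.coeFn_toLp (p := 2) (𝕜 := ℂ) (@haarAddCircle (1:ℝ) _) G,
      ContinuousMap.coeFn_toLp (p := 2) (𝕜 := ℂ) (@haarAddCircle (1:ℝ) _) (((1 - ‖c‖ ^ 2 : ℝ) : ℂ) • fourier 0 - (starRingEnd ℂ) c • G)] with x h1 h2
    rw [h1, h2]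
    exact hpt x
  have hexp : ‖((1 - ‖c‖ ^ 2 : ℝ) : ℂ) • fourierLp (T := (1:ℝ)) 2 0 - (starRingEnd ℂ) c • F‖ ^ 2 =
      (1 - ‖c‖ ^ 2) ^ 2 + ‖c‖ ^ 2 * ‖F‖ ^ 2 := by
    rw [norm_sub_sq (𝕜 := ℂ), inner_smul_left, inner_smul_right, h0, norm_smul, norm_smul,
      (orthonormal_fourier (T := (1:ℝ))).1 0, Complex.norm_real, RCLike.norm_conj]
    simp [mul_pow]
  have hsq : ‖F‖ ^ 2 ≤ s ^ 2 * ((1 - ‖c‖ ^ 2) ^ 2 + ‖c‖ ^ 2 * ‖F‖ ^ 2) := by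
    rw [← hexp, ← mul_pow]
    exact pow_le_pow_left₀ (norm_nonneg _) hnorm 2
  by_cases hc : 0 ≤ 1 - ‖c‖ ^ 2 * s ^ 2
  · nlinarith [mul_le_mul_of_nonneg_right hbessel hc]
  · have : 0 ≤ ∑ k ∈ Finset.range n, ‖b k‖ ^ 2 := Finset.sum_nonneg (fun _ _ => by positivity)
    nlinarith [mul_nonneg this (le_of_lt (neg_pos.2 (not_le.1 hc))), mul_nonneg (sq_nonneg s) (sq_nonneg (1 - ‖c‖^2))]

lemma aux_norm_ineq (u v : ℂ) (hu : ‖u‖ ≤ 1) (hv : ‖v‖ ≤ 1) :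
    ‖v - u‖ ≤ ‖1 - (starRingEnd ℂ) u * v‖ := by
  apply le_of_sq_le_sq _ (norm_nonneg _)
  have h1 : u.re ^ 2 + u.im ^ 2 ≤ 1 := by
    have : ‖u‖ ^ 2 ≤ 1 := pow_le_one₀ (norm_nonneg _) hu
    rw [← Complex.normSq_eq_norm_sq, Complex.normSq_apply] at this; nlinarith
  have h2 : v.re ^ 2 + v.im ^ 2 ≤ 1 := by
    have : ‖v‖ ^ 2 ≤ 1 := pow_le_one₀ (norm_nonneg _) hv
    rw [← Complex.normSq_eq_norm_sq, Complex.normSq_apply] at this; nlinarith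
  rw [← Complex.normSq_eq_norm_sq, ← Complex.normSq_eq_norm_sq, Complex.normSq_apply,
    Complex.normSq_apply]
  simp
  nlinarith [mul_nonneg (sub_nonneg.2 h1) (sub_nonneg.2 h2)]

lemma aux_pick0 (g : ℂ → ℂ) (hg : DifferentiableOn ℂ g (Metric.ball 0 1)) (t : ℝ) (ht : t < 1)
    (hb : ∀ z ∈ Metric.ball (0 : ℂ) 1, ‖g z‖ ≤ t) (w : ℂ) (hw : ‖w‖ < 1) :
    ‖g w - g 0‖ ≤ ‖w‖ * ‖1 - (starRingEnd ℂ) (g 0) * g w‖ := by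
  have h0 : ‖g 0‖ ≤ t := hb 0 (by simp)
  have hne : ∀ z ∈ Metric.ball (0 : ℂ) 1, 1 - (starRingEnd ℂ) (g 0) * g z ≠ 0 := by
    intro z hz h
    have h1 : ‖(starRingEnd ℂ) (g 0) * g z‖ = 1 := by rw [← sub_eq_zero.1 h]; simp
    rw [norm_mul, RCLike.norm_conj] at h1
    nlinarith [hb z hz, norm_nonneg (g z), norm_nonneg (g 0)]
  have hd : DifferentiableOn ℂ (fun z => (g z - g 0) / (1 - (starRingEnd ℂ) (g 0) * g z))
      (Metric.ball 0 1) :=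
    (hg.sub_const _).div ((hg.const_mul _).const_sub _) hne
  have := Complex.norm_le_norm_of_mapsTo_ball (z := w) hd (by
    intro z hz
    rw [mem_closedBall_zero_iff, norm_div]
    exact div_le_one_of_le₀ (aux_norm_ineq _ _ (by linarith) (by linarith [hb z hz])) (norm_nonneg _))
    (by simp) hw
  rw [norm_div, div_le_iff₀ (norm_pos_iff.2 (hne w (by simpa using hw)))] at this
  exact this

lemma aux_pick (g : ℂ → ℂ) (hg : DifferentiableOn ℂ g (Metric.ball 0 1))
    (hb : ∀ z ∈ Metric.ball (0 : ℂ) 1, ‖g z‖ ≤ 1) (w : ℂ) (hw : ‖w‖ < 1) :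
    ‖g w - g 0‖ ≤ ‖w‖ * ‖1 - (starRingEnd ℂ) (g 0) * g w‖ := by
  have key : ∀ t ∈ Set.Ioo (0 : ℝ) 1, ‖(t : ℂ) * g w - t * g 0‖ ≤
      ‖w‖ * ‖1 - (starRingEnd ℂ) (t * g 0) * (t * g w)‖ := by
    intro t ht
    apply aux_pick0 (fun z => (t : ℂ) * g z) (hg.const_mul _) t ht.2 _ w hw
    intro z hz
    rw [norm_mul, Complex.norm_real, Real.norm_of_nonneg ht.1.le]
    nlinarith [hb z hz, ht.1]
  have hcl : (1 : ℝ) ∈ closure (Set.Ioo (0 : ℝ) 1) := by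
    rw [closure_Ioo (by norm_num)]; simp
  have := closure_minimal (s := Set.Ioo (0:ℝ) 1) (t := {t : ℝ | ‖(t : ℂ) * g w - t * g 0‖ ≤
      ‖w‖ * ‖1 - (starRingEnd ℂ) (t * g 0) * (t * g w)‖}) key (by
      apply isClosed_le
      · fun_prop
      · simp only [map_mul, Complex.conj_ofReal]; fun_prop) hcl
  simpa using this

/-- coefficient estimate -/
lemma aux_coeff (a : ℕ → ℂ) (g : ℂ → ℂ)
    (hg : ∀ w ∈ Metric.ball (0 : ℂ) 1, HasSum (fun k : ℕ => a k * w ^ k) (g w))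
    (hd : DifferentiableOn ℂ g (Metric.ball 0 1))
    (hb : ∀ z ∈ Metric.ball (0 : ℂ) 1, ‖g z‖ ≤ 1) (R : ℝ) (hR0 : 0 ≤ R) (hR : R ≤ 1) (n : ℕ) :
    (∑ k ∈ Finset.range n, ‖a (k + 1)‖ ^ 2 * R ^ (k + 1)) * (1 - ‖a 0‖ ^ 2 * R) ≤
      R * (1 - ‖a 0‖ ^ 2) ^ 2 := by
  have hg0 : g 0 = a 0 := by
    refine (hg 0 (by simp)).unique ?_
    convert hasSum_ite_eq 0 (a 0) using 2 with k
    by_cases h : k = 0 <;> simp [h]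
  have key : ∀ s ∈ Set.Ico (0 : ℝ) 1,
    (∑ k ∈ Finset.range n, ‖a (k + 1)‖ ^ 2 * (s ^ 2) ^ (k + 1)) * (1 - ‖a 0‖ ^ 2 * s ^ 2) ≤
      s ^ 2 * (1 - ‖a 0‖ ^ 2) ^ 2 := by
    intro s hs
    have hn := aux_l2 (fun k => a (k + 1) * (s : ℂ) ^ (k + 1)) (by
      have := (hg s (by simpa [abs_of_nonneg hs.1] using hs.2)).summable.norm
      exact (summable_nat_add_iff 1).2 this) (a 0) s hs.1 (by
      intro e G he hG
      have hn : ‖(s : ℂ) * e‖ = s := by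
        rw [norm_mul, he, mul_one, Complex.norm_real, Real.norm_of_nonneg hs.1]
      have hm : (s : ℂ) * e ∈ Metric.ball (0 : ℂ) 1 := by
        rw [mem_ball_zero_iff, hn]; exact hs.2
      have hGe : G = g (s * e) - a 0 := by
        refine hG.unique ?_
        have := (hasSum_nat_add_iff' 1).2 (hg _ hm)
        simpa [mul_pow, mul_assoc] using this
      have hp := aux_pick g hd hb (s * e) (by rw [hn]; exact hs.2)
      rw [hn, hg0] at hp
      rw [hGe]
      convert hp using 3
      push_cast
      rw [← Complex.conj_mul']
      ring) n
    convert hn using 3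
    rw [norm_mul, norm_pow, Complex.norm_real, Real.norm_of_nonneg hs.1]
    ring
  have hcl : Real.sqrt R ∈ closure (Set.Ico (0 : ℝ) 1) := by
    rw [closure_Ico (by norm_num)]; exact ⟨Real.sqrt_nonneg _, Real.sqrt_le_one.2 hR⟩
  have := closure_minimal (s := Set.Ico (0:ℝ) 1) (t := {s : ℝ |
    (∑ k ∈ Finset.range n, ‖a (k + 1)‖ ^ 2 * (s ^ 2) ^ (k + 1)) * (1 - ‖a 0‖ ^ 2 * s ^ 2) ≤
      s ^ 2 * (1 - ‖a 0‖ ^ 2) ^ 2}) (fun s hs => by rw [Set.mem_ofPred_eq]; exact key s hs) (by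
      apply isClosed_le <;> fun_prop) hcl
  simpa only [Set.mem_ofPred_eq, Real.sq_sqrt hR0] using this

lemma aux_final (a : ℕ → ℝ) (ha : ∀ k, 0 ≤ a k) (ha0 : a 0 ≤ 1)
    (H : ∀ R : ℝ, 0 ≤ R → R ≤ 1 → ∀ n : ℕ,
      (∑ k ∈ Finset.range n, a (k + 1) ^ 2 * R ^ (k + 1)) * (1 - a 0 ^ 2 * R) ≤
      R * (1 - a 0 ^ 2) ^ 2) (x q : ℝ) (hx : 0 < x) (hx1 : x < 1) (hq : 1 < q) (hxq : q * x ≤ 1) :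
    ∑' k : ℕ, a (k + 1) * x ^ (k + 1) ≤ x * (1 - a 0 ^ 2) /
      (Real.sqrt (1 - a 0 ^ 2 * x * q) * Real.sqrt (1 - q⁻¹ * x)) := by
  have hq0 : 0 < q := by linarith
  have hnn : 0 ≤ 1 - a 0 ^ 2 := by nlinarith [ha 0]
  apply Real.tsum_le_of_sum_range_le (fun k => mul_nonneg (ha _) (by positivity))
  intro n
  rcases eq_or_lt_of_le ha0 with h1 | h1
  · have hz : ∀ k, a (k + 1) = 0 := by
      intro k
      have h := H (1 / 2) (by norm_num) (by norm_num) (k + 1)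
      rw [h1] at h
      have h2 : a (k + 1) ^ 2 * (1 / 2) ^ (k + 1) ≤
          ∑ k ∈ Finset.range (k + 1), a (k + 1) ^ 2 * (1 / 2 : ℝ) ^ (k + 1) :=
        Finset.single_le_sum (f := fun k => a (k + 1) ^ 2 * (1 / 2 : ℝ) ^ (k + 1))
          (fun _ _ => by positivity) (by simp)
      have h3 : a (k + 1) ^ 2 * (1 / 2 : ℝ) ^ (k + 1) ≤ 0 := by linarith
      have h4 : (0 : ℝ) < (1 / 2) ^ (k + 1) := by positivity
      have h5 : a (k + 1) ^ 2 ≤ 0 := by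
        by_contra h; nlinarith [mul_pos (not_le.1 h) h4]
      exact pow_eq_zero_iff (two_ne_zero) |>.1 (le_antisymm h5 (sq_nonneg _))
    simp [hz, h1]
  · have hA : 0 < 1 - a 0 ^ 2 * x * q := by
      have : a 0 ^ 2 < 1 := by nlinarith [ha 0]
      nlinarith [mul_pos hx hq0, sq_nonneg (a 0)]
    have hy1 : q⁻¹ * x < 1 := by
      have := inv_lt_one_of_one_lt₀ hq
      have := inv_pos.2 hq0
      nlinarith
    have hy0 : 0 < q⁻¹ * x := by positivity
    have hB : 0 < 1 - q⁻¹ * x := by linarith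
    rw [← Real.sqrt_mul hA.le]
    rw [le_div_iff₀ (Real.sqrt_pos.2 (mul_pos hA hB))]
    have hS0 : 0 ≤ ∑ k ∈ Finset.range n, a (k + 1) * x ^ (k + 1) :=
      Finset.sum_nonneg (fun k _ => mul_nonneg (ha _) (by positivity))
    have hcs : (∑ k ∈ Finset.range n, a (k + 1) * x ^ (k + 1)) ^ 2 ≤
      (∑ k ∈ Finset.range n, a (k + 1) ^ 2 * (q * x) ^ (k + 1)) *
        ∑ k ∈ Finset.range n, (q⁻¹ * x) ^ (k + 1) := by
      apply Finset.sum_sq_le_sum_mul_sum_of_sq_eq_mul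
      · intro k _; positivity
      · intro k _; positivity
      · intro k _
        have : (q * x) ^ (k + 1) * (q⁻¹ * x) ^ (k + 1) = (x ^ (k + 1)) ^ 2 := by
          rw [← mul_pow, ← pow_mul, mul_comm (k + 1) 2, pow_mul]
          congr 1
          field_simp
        rw [mul_assoc, this, mul_pow]
    have h1 := H (q * x) (by positivity) hxq n
    have hgeo : (∑ k ∈ Finset.range n, (q⁻¹ * x) ^ (k + 1)) * (1 - q⁻¹ * x) ≤ q⁻¹ * x := by
      have e : ∑ k ∈ Finset.range n, (q⁻¹ * x) ^ (k + 1) =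
          (∑ k ∈ Finset.range n, (q⁻¹ * x) ^ k) * (q⁻¹ * x) := by
        rw [Finset.sum_mul]; rfl
      have h := geom_sum_mul_neg (q⁻¹ * x) n
      rw [e, mul_right_comm, h]
      nlinarith [pow_pos hy0 n]
    apply le_of_sq_le_sq _ (mul_nonneg hx.le hnn)
    rw [mul_pow, Real.sq_sqrt (mul_pos hA hB).le]
    have hG0 : 0 ≤ ∑ k ∈ Finset.range n, (q⁻¹ * x) ^ (k + 1) :=
      Finset.sum_nonneg (fun k _ => by positivity)
    calc _ ≤ _ := mul_le_mul_of_nonneg_right hcs (mul_pos hA hB).le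
      _ = ((∑ k ∈ Finset.range n, a (k + 1) ^ 2 * (q * x) ^ (k + 1)) * (1 - a 0 ^ 2 * (q * x))) *
        ((∑ k ∈ Finset.range n, (q⁻¹ * x) ^ (k + 1)) * (1 - q⁻¹ * x)) := by ring
      _ ≤ (q * x * (1 - a 0 ^ 2) ^ 2) * (q⁻¹ * x) :=
        mul_le_mul h1 hgeo (mul_nonneg hG0 hB.le) (by positivity)
      _ = (x * (1 - a 0 ^ 2)) ^ 2 := by field_simp

lemma aux_diff (a : ℕ → ℂ)
    (hs : ∀ w ∈ Metric.ball (0 : ℂ) 1, Summable (fun k : ℕ => a k * w ^ k)) :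
    DifferentiableOn ℂ (fun w => ∑' k, a k * w ^ k) (Metric.ball 0 1) := by
  intro w hw
  rw [mem_ball_zero_iff] at hw
  obtain ⟨s, hs1, hs2⟩ := exists_between hw
  have hs0 : 0 ≤ s := (norm_nonneg _).trans hs1.le
  have hsm := (hs s (by simpa [abs_of_nonneg hs0] using hs2)).norm
  have := Complex.differentiableOn_tsum_of_summable_norm (U := Metric.ball 0 s)
    (F := fun k w => a k * w ^ k) hsm
    (fun k => by fun_prop) Metric.isOpen_ball (by
      intro k z hz
      rw [mem_ball_zero_iff] at hz
      simp only [norm_mul, norm_pow, Complex.norm_real, Real.norm_of_nonneg hs0]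
      gcongr)
  exact (this.differentiableAt (Metric.isOpen_ball.mem_nhds (by simpa using hs1))).differentiableWithinAt

/-- Key estimate for the tail of the majorant series of a bounded `p`-symmetric function:
if `f(z) = ∑_{k≥0} a_{pk+1} z^{pk+1}` with `|f| ≤ 1` on 𝔻 and `a = |a_1|`, then for all
`0 < r < 1` and `ρ > 1` with `ρ r ≤ 1`,
`∑_{k≥1} |a_{pk+1}| r^{pk} ≤ r^p (1-a²) / (√(1 - a² r^p ρ^p) √(1 - ρ^{-p} r^p))`. -/
theorem tail_majorant_bound (p : ℕ) (hp : 0 < p) (f : ℂ → ℂ) (a : ℕ → ℂ)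
    (hf : ∀ z ∈ Metric.ball (0 : ℂ) 1, HasSum (fun k : ℕ => a k * z ^ (p * k + 1)) (f z))
    (hb : ∀ z ∈ Metric.ball (0 : ℂ) 1, ‖f z‖ ≤ 1) :
    ∀ r ρ : ℝ, 0 < r → r < 1 → 1 < ρ → ρ * r ≤ 1 →
      ∑' k : ℕ, ‖a (k + 1)‖ * r ^ (p * (k + 1)) ≤
        r ^ p * (1 - ‖a 0‖ ^ 2) /
          (Real.sqrt (1 - ‖a 0‖ ^ 2 * r ^ p * ρ ^ p) * Real.sqrt (1 - (ρ ^ p)⁻¹ * r ^ p)) := by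
  intro r ρ hr hr1 hρ hρr
  have hroot : ∀ w : ℂ, w ∈ Metric.ball (0 : ℂ) 1 → ∃ z ∈ Metric.ball (0 : ℂ) 1, z ^ p = w := by
    intro w hw
    obtain ⟨z, hz⟩ := IsAlgClosed.exists_pow_nat_eq w hp
    refine ⟨z, ?_, hz⟩
    rw [mem_ball_zero_iff] at hw ⊢
    rw [← hz, norm_pow] at hw
    by_contra h
    exact absurd (one_le_pow₀ (not_lt.1 h)) (not_le.2 hw)
  have hsum : ∀ w ∈ Metric.ball (0 : ℂ) 1, Summable (fun k : ℕ => a k * w ^ k) := by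
    intro w hw
    by_cases h0 : w = 0
    · subst h0
      apply summable_of_ne_finset_zero (s := {0})
      intro k hk
      simp at hk
      simp [hk]
    · obtain ⟨z, hz, rfl⟩ := hroot w hw
      have hz0 : z ≠ 0 := by rintro rfl; simp [hp.ne'] at h0
      have := (hf z hz).summable.mul_right z⁻¹
      refine this.congr (fun k => ?_)
      rw [pow_succ, pow_mul, mul_assoc, mul_assoc, mul_inv_cancel₀ hz0, mul_one]
  set g : ℂ → ℂ := fun w => ∑' k, a k * w ^ k with hgdef
  have hg : ∀ w ∈ Metric.ball (0 : ℂ) 1, HasSum (fun k : ℕ => a k * w ^ k) (g w) :=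
    fun w hw => (hsum w hw).hasSum
  have hd : DifferentiableOn ℂ g (Metric.ball 0 1) := aux_diff a hsum
  have hpow : ∀ z ∈ Metric.ball (0 : ℂ) 1, z ^ p ∈ Metric.ball (0 : ℂ) 1 := by
    intro z hz
    rw [mem_ball_zero_iff] at hz ⊢
    rw [norm_pow]; exact pow_lt_one₀ (norm_nonneg _) hz hp.ne'
  have hfg : ∀ z ∈ Metric.ball (0 : ℂ) 1, f z = z * g (z ^ p) := by
    intro z hz
    refine (hf z hz).unique ?_
    have h := (hg _ (hpow z hz)).mul_left z
    have e : (fun k : ℕ => a k * z ^ (p * k + 1)) = fun k : ℕ => z * (a k * (z ^ p) ^ k) := by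
      funext k
      rw [pow_succ, pow_mul]; ring
    rw [e]; exact h
  have hfd : DifferentiableOn ℂ f (Metric.ball 0 1) := by
    refine DifferentiableOn.congr ?_ hfg
    exact differentiableOn_id.mul (hd.comp (by fun_prop) hpow)
  have hgb' : ∀ w ∈ Metric.ball (0 : ℂ) 1, w ≠ 0 → ‖g w‖ ≤ 1 := by
    intro w hw h0
    obtain ⟨z, hz, rfl⟩ := hroot w hw
    have hz0 : z ≠ 0 := by rintro rfl; simp [hp.ne'] at h0
    have h := Complex.norm_le_norm_of_mapsTo_ball (z := z) hfd
      (fun z hz => by simpa using hb z hz) (by simp [hfg 0]) (by simpa using hz)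
    rw [hfg z hz, norm_mul] at h
    have := norm_pos_iff.2 hz0
    nlinarith
  have hgb : ∀ w ∈ Metric.ball (0 : ℂ) 1, ‖g w‖ ≤ 1 := by
    intro w hw
    by_cases h0 : w = 0
    · subst h0
      have hc : ContinuousAt g 0 := (hd.differentiableAt (Metric.isOpen_ball.mem_nhds hw)).continuousAt
      have ht : Filter.Tendsto (fun z => ‖g z‖) (nhdsWithin 0 {0}ᶜ) (nhds ‖g 0‖) :=
        (hc.norm.tendsto).mono_left nhdsWithin_le_nhds
      apply le_of_tendsto ht
      filter_upwards [self_mem_nhdsWithin, mem_nhdsWithin_of_mem_nhds (Metric.isOpen_ball.mem_nhds hw)] with z h1 h2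
      exact hgb' z h2 h1
    · exact hgb' w hw h0
  have hg0 : g 0 = a 0 := by
    refine (hg 0 (by simp)).unique ?_
    convert hasSum_ite_eq 0 (a 0) using 2 with k
    by_cases h : k = 0 <;> simp [h]
  have hfin := aux_final (fun k => ‖a k‖) (fun k => norm_nonneg _)
    (by rw [← hg0]; exact hgb 0 (by simp))
    (fun R h0 h1 n => aux_coeff a g hg hd hgb R h0 h1 n) (r ^ p) (ρ ^ p) (by positivity)
    (pow_lt_one₀ hr.le hr1 hp.ne') (one_lt_pow₀ hρ hp.ne')
    (by rw [← mul_pow]; exact pow_le_one₀ (by positivity) hρr)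
  simpa only [← pow_mul] using hfin
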